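/- Let G be a pointed graph with pebbling number ♯G = N, let p be a positive integer, and let σ : G → Var(G)^p be good for G, N/2, and p (i.e., for all A ⊆ G and B ⊆ Var(G) with |A| = |B| = ⌊N/2⌋, |σ(A) ∩ B| ≥ N/4). Then every regular resolution refutation of Peb^σ(G) contains a clause of width at least N/4. -/

import Mathlib

attribute [local instance] Classical.propDecidable

/-- A clause: a finite set of literals, a literal being a variable with a sign. -/
abbrev Clause := Finset (ℕ × Bool)

/-- A total truth assignment satisfies a clause if it makes some literal true. -/
def clauseSat (a : ℕ → Bool) (C : Clause) : Prop :=
  ∃ l ∈ C, (if l.2 then a l.1 else !(a l.1)) = true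

/-- A set of clauses is unsatisfiable (contradictory). -/
def Unsat (S : Set Clause) : Prop := ∀ a : ℕ → Bool, ¬ ∀ C ∈ S, clauseSat a C

/-- A directed graph with a designated sink vertex. -/
structure PGraph where
  verts : Finset ℕ
  edges : Finset (ℕ × ℕ)
  sink : ℕ

def edgeRel (G : PGraph) (u v : ℕ) : Prop := (u, v) ∈ G.edges

def Reach (G : PGraph) (u v : ℕ) : Prop := Relation.ReflTransGen (edgeRel G) u v

noncomputable def preds (G : PGraph) (v : ℕ) : Finset ℕ :=
  (G.edges.filter (fun e => e.2 = v)).image Prod.fst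

/-- A pointed graph: a DAG whose edges join vertices, indegrees at most 2, with a
unique sink belonging to the graph and reachable from every vertex. -/
def IsPointed (G : PGraph) : Prop :=
  G.sink ∈ G.verts ∧
  (∀ e ∈ G.edges, e.1 ∈ G.verts ∧ e.2 ∈ G.verts) ∧
  (∀ v, ¬ Relation.TransGen (edgeRel G) v v) ∧
  (∀ v ∈ G.verts, (preds G v).card ≤ 2) ∧
  (∀ v ∈ G.verts, Reach G v G.sink)

/-- The clause of the pebbling formula associated with a vertex: the negations of its
predecessors, together with the vertex itself positively (omitted at the sink, which
plays the role of ⊥). Sources thus get unit clauses. -/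
noncomputable def ClauseOf (G : PGraph) (v : ℕ) : Clause :=
  ((preds G v).image (fun u => (u, false))) ∪
    (if v = G.sink then (∅ : Clause) else {(v, true)})

/-- The pebbling formula Peb(G). -/
noncomputable def Peb (G : PGraph) : Set Clause := (fun v => ClauseOf G v) '' ↑G.verts

/-- A legal move of the pebbling game: place a pebble on a vertex all of whose
predecessors are pebbled (for sources this allows placement at any time), or remove
a pebble from any vertex. -/
def PebStep (G : PGraph) (C D : Finset ℕ) : Prop :=
  (∃ v ∈ G.verts, preds G v ⊆ C ∧ D = insert v C) ∨ (∃ v, D = C.erase v)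

/-- A (successful) strategy for the pebbling game on G: a sequence of configurations
starting from the empty configuration, each obtained from the previous by a legal
move, ending with a pebble on the sink. -/
def IsStrategy (G : PGraph) (L : List (Finset ℕ)) : Prop :=
  L.head? = some ∅ ∧ (∃ C, L.getLast? = some C ∧ G.sink ∈ C) ∧ List.Chain' (PebStep G) L

/-- The cost of a strategy: the maximum number of pebbles simultaneously on the graph. -/
def cost (L : List (Finset ℕ)) : ℕ := (L.map Finset.card).foldr max 0

/-- The pebbling number ♯G: the minimum cost of a strategy for the pebbling game on G. -/
noncomputable def pebNum (G : PGraph) : ℕ :=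
  sInf { p | ∃ L : List (Finset ℕ), IsStrategy G L ∧ cost L ≤ p }

/-- Tree-style resolution derivations: a binary tree whose leaves are (occurrences of)
input clauses and whose internal nodes are resolution inferences on a stated variable. -/
inductive RTree where
  | leaf : Clause → RTree
  | node : ℕ → RTree → RTree → RTree

/-- Conclusion clause of a resolution tree. -/
def conc : RTree → Clause
  | .leaf C => C
  | .node x l r => (conc l).erase (x, true) ∪ (conc r).erase (x, false)

/-- Validity: leaves are clauses of S, and each step resolves a variable occurring
positively in the left premiss and negatively in the right premiss. -/
def valid (S : Set Clause) : RTree → Prop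
  | .leaf C => C ∈ S
  | .node x l r => (x, true) ∈ conc l ∧ (x, false) ∈ conc r ∧ valid S l ∧ valid S r

/-- Size: the number of clause occurrences. -/
def tsize : RTree → ℕ
  | .leaf _ => 1
  | .node _ l r => tsize l + tsize r + 1

/-- Width: the maximum width of a clause occurring in the tree. -/
def twidth : RTree → ℕ
  | .leaf C => C.card
  | .node x l r => max (conc (RTree.node x l r)).card (max (twidth l) (twidth r))

/-- The variables resolved upon in a tree. -/
def resolvedVars : RTree → Finset ℕ
  | .leaf _ => ∅
  | .node x l r => insert x (resolvedVars l ∪ resolvedVars r)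

/-- Regularity: no variable is resolved upon twice along any path. -/
def regular : RTree → Prop
  | .leaf _ => True
  | .node x l r => x ∉ resolvedVars l ∧ x ∉ resolvedVars r ∧ regular l ∧ regular r

/-- A tree-style resolution refutation of S. -/
def IsTreeRefutation (S : Set Clause) (t : RTree) : Prop := valid S t ∧ conc t = ∅

/-- S has a regular resolution refutation of width at most k.  (Regular refutations
unfold, width for width, into regular tree-style refutations, so regular refutation
width is captured by regular trees.) -/
def HasRegularRefutationOfWidth (S : Set Clause) (k : ℕ) : Prop :=
  ∃ t : RTree, IsTreeRefutation S t ∧ regular t ∧ twidth t ≤ k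

/-- The augmented pebbling formula Peb^σ(G): for each vertex v and each sign pattern
ε ∈ {0,1}^p, the clause Clause(v) ∨ ±σ₁(v) ∨ ⋯ ∨ ±σ_p(v). -/
noncomputable def PebS (G : PGraph) {p : ℕ} (σ : ℕ → Fin p → ℕ) : Set Clause :=
  { C | ∃ v ∈ G.verts, ∃ ε : Fin p → Bool,
      C = ClauseOf G v ∪ Finset.image (fun i : Fin p => (σ v i, ε i)) Finset.univ }

/-- Configurations reachable with at most `k` pebbles, the vertices of `T` being free. -/
inductive PR (G : PGraph) (T : Finset ℕ) (k : ℕ) : Finset ℕ → Prop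
  | empty : PR G T k ∅
  | place (C : Finset ℕ) (v : ℕ) : PR G T k C → v ∈ G.verts → preds G v ⊆ C ∪ T →
      (insert v C).card ≤ k → PR G T k (insert v C)
  | rem (C : Finset ℕ) (v : ℕ) : PR G T k C → PR G T k (C.erase v)

/-- Edges avoiding `T`. -/
def ER (G : PGraph) (T : Finset ℕ) (u v : ℕ) : Prop := (u, v) ∈ G.edges ∧ u ∉ T ∧ v ∉ T

/-- Reachability avoiding `T`. -/
def RT (G : PGraph) (T : Finset ℕ) (u v : ℕ) : Prop := Relation.ReflTransGen (ER G T) u v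

theorem mem_preds (G : PGraph) (u v : ℕ) : u ∈ preds G v ↔ (u, v) ∈ G.edges := by
  simp [preds]

theorem PR.mono {G : PGraph} {T : Finset ℕ} {k m : ℕ} (h : k ≤ m) {C : Finset ℕ}
    (hC : PR G T k C) : PR G T m C := by
  induction hC with
  | empty => exact .empty
  | place C v _ hv hp hc ih => exact .place C v ih hv hp (hc.trans h)
  | rem C v _ ih => exact .rem C v ih

theorem PR.sub {G : PGraph} {T : Finset ℕ} {k : ℕ} {C D : Finset ℕ}
    (hC : PR G T k C) (hD : D ⊆ C) : PR G T k D := by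
  have key : ∀ E : Finset ℕ, PR G T k (C \ E) := by
    intro E
    induction E using Finset.induction_on with
    | empty => simpa using hC
    | insert a E _ ih =>
      have h := PR.rem _ a ih
      have e : C \ insert a E = (C \ E).erase a := by
        ext y; simp only [Finset.mem_sdiff, Finset.mem_insert, Finset.mem_erase]; tauto
      rw [e]; exact h
  have h := key (C \ D)
  rwa [Finset.sdiff_sdiff_eq_self hD] at h

theorem PR.compose {G : PGraph} {T : Finset ℕ} {k x : ℕ} {C1 : Finset ℕ}
    (h1 : PR G T k C1) (hx : x ∈ C1) {C : Finset ℕ} (h : PR G (insert x T) k C) :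
    PR G T (k + 1) (insert x C) := by
  induction h with
  | empty =>
    exact (h1.mono (Nat.le_succ k)).sub (by simpa using hx)
  | place C v _ hv hp hc ih =>
    rw [Finset.insert_comm]
    refine .place _ v ih hv ?_ ?_
    · intro y hy
      have := hp hy
      simp only [Finset.mem_union, Finset.mem_insert] at this ⊢
      tauto
    · rw [Finset.insert_comm]
      exact (Finset.card_insert_le _ _).trans (by omega)
  | rem C v _ ih =>
    refine ih.sub ?_
    exact Finset.insert_subset_insert _ (Finset.erase_subset _ _)

theorem PR.irrel {G : PGraph} {T : Finset ℕ} {k x s : ℕ} (hs : s ∉ T)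
    (hx : ¬ RT G T x s) {C : Finset ℕ} (h : PR G (insert x T) k C) :
    PR G T k (C.filter (fun u => RT G T u s)) := by
  induction h with
  | empty => simpa using PR.empty
  | place C v _ hv hp hc ih =>
    rw [Finset.filter_insert]
    split_ifs with hr
    · refine .place _ v ih hv ?_ ?_
      · intro y hy
        have h1 := hp hy
        rw [mem_preds] at hy
        have hvT : v ∉ T := by
          rcases Relation.ReflTransGen.cases_head hr with e | ⟨c, hc, _⟩
          · rwa [e]
          · exact hc.2.1
        by_cases hyT : y ∈ T
        · simp [hyT]
        · have hys : RT G T y s := Relation.ReflTransGen.head ⟨hy, hyT, hvT⟩ hr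
          have hyx : y ≠ x := fun e => hx (e ▸ hys)
          simp only [Finset.mem_union, Finset.mem_insert, Finset.mem_filter] at h1 ⊢
          tauto
      · refine (Finset.card_le_card ?_).trans hc
        exact Finset.insert_subset_insert _ (Finset.filter_subset _ _)
    · exact ih
  | rem C v _ ih =>
    refine ih.sub ?_
    exact Finset.filter_subset_filter _ (Finset.erase_subset _ _)

theorem exists_list {G : PGraph} {k : ℕ} {C : Finset ℕ} (h : PR G ∅ k C) :
    ∃ L : List (Finset ℕ), L.head? = some ∅ ∧ L.getLast? = some C ∧
      List.IsChain (PebStep G) L ∧ cost L ≤ k := by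
  have costApp : ∀ (L : List (Finset ℕ)) (D : Finset ℕ), cost L ≤ k → D.card ≤ k →
      cost (L ++ [D]) ≤ k := by
    intro L D h1 h2
    induction L with
    | nil => simpa [cost] using h2
    | cons a L ih =>
      simp only [cost, List.map_cons, List.foldr_cons, List.cons_append, max_le_iff] at h1 ih ⊢
      exact ⟨h1.1, ih h1.2⟩
  have cardk : ∀ D, PR G ∅ k D → D.card ≤ k := by
    intro D hD
    induction hD with
    | empty => simp
    | place C v _ hv hp hc ih => exact hc
    | rem C v _ ih => exact (Finset.card_le_card (Finset.erase_subset _ _)).trans ih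
  have app : ∀ C D, (∃ L : List (Finset ℕ), L.head? = some ∅ ∧ L.getLast? = some C ∧
      List.IsChain (PebStep G) L ∧ cost L ≤ k) → PebStep G C D → D.card ≤ k →
      (∃ L : List (Finset ℕ), L.head? = some ∅ ∧ L.getLast? = some D ∧
      List.IsChain (PebStep G) L ∧ cost L ≤ k) := by
    rintro C D ⟨L, h1, h2, h3, h4⟩ hs hD
    refine ⟨L ++ [D], ?_, by simp, ?_, costApp _ _ h4 hD⟩
    · rw [List.head?_append, h1]; rfl
    · rw [List.isChain_append]
      refine ⟨h3, by simp, ?_⟩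
      intro x hx y hy
      rw [h2] at hx
      simp at hx hy
      subst hx; subst hy; exact hs
  induction h with
  | empty => exact ⟨[∅], rfl, rfl, by simp, by simp [cost]⟩
  | place C v hC hv hp hc ih =>
    exact app C _ ih (Or.inl ⟨v, hv, by simpa using hp, rfl⟩) hc
  | rem C v hC ih => exact app C _ ih (Or.inr ⟨v, rfl⟩) (cardk _ (.rem C v hC))

theorem pebNum_le {G : PGraph} {k : ℕ} {C : Finset ℕ} (h : PR G ∅ k C) (hs : G.sink ∈ C) :
    pebNum G ≤ k := by
  obtain ⟨L, h1, h2, h3, h4⟩ := exists_list h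
  exact Nat.sInf_le ⟨L, ⟨h1, ⟨C, h2, hs⟩, h3⟩, h4⟩

theorem RT.notMem {G : PGraph} {T : Finset ℕ} {u v : ℕ} (h : RT G T u v) (hv : v ∉ T) :
    u ∉ T := by
  rcases Relation.ReflTransGen.cases_head h with e | ⟨c, hc, _⟩
  · rwa [e]
  · exact hc.2.1

theorem RT.notMem' {G : PGraph} {T : Finset ℕ} {u v : ℕ} (h : RT G T u v) (hv : u ∉ T) :
    v ∉ T := by
  rcases Relation.ReflTransGen.cases_tail h with e | ⟨c, _, hc⟩
  · rwa [e]
  · exact hc.2.2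

theorem pebble_all {G : PGraph} (hG : IsPointed G) (T : Finset ℕ) (s : ℕ) (hs : s ∉ T)
    (hsv : s ∈ G.verts) :
    ∃ C, PR G T (G.verts.filter (fun v => RT G T v s)).card C ∧ s ∈ C := by
  set A := G.verts.filter (fun v => RT G T v s) with hA
  have hne : (A.powerset.filter (fun C => PR G T A.card C)).Nonempty :=
    ⟨∅, by simp [PR.empty]⟩
  obtain ⟨C, hC, hmax⟩ := Finset.exists_max_image _ Finset.card hne
  simp only [Finset.mem_filter, Finset.mem_powerset] at hC hmax
  have hsA : s ∈ A := by
    rw [hA, Finset.mem_filter]; exact ⟨hsv, Relation.ReflTransGen.refl⟩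
  refine ⟨C, hC.2, ?_⟩
  by_contra hsC
  -- well-founded minimal element of A \ C
  have wf : (↑(A \ C) : Set ℕ).WellFoundedOn (Relation.TransGen (edgeRel G)) := by
    haveI : IsStrictOrder ℕ (Relation.TransGen (edgeRel G)) :=
      { irrefl := hG.2.2.1, trans := fun a b c h1 h2 => h1.trans h2 }
    exact (Finset.finite_toSet _).wellFoundedOn
  have hne2 : (↑(A \ C) : Set ℕ).Nonempty := ⟨s, by simp [hsA, hsC]⟩
  obtain ⟨v, hv, hmin⟩ : ∃ v ∈ A \ C, ∀ u ∈ A \ C, ¬ Relation.TransGen (edgeRel G) u v := by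
    obtain ⟨v, _, hm⟩ := WellFounded.has_min wf Set.univ
      (⟨⟨s, by simp [hsA, hsC]⟩, trivial⟩)
    exact ⟨v.1, by simpa using v.2, fun u hu => hm ⟨u, by simpa using hu⟩ trivial⟩
  rw [Finset.mem_sdiff] at hv
  have hvA := (Finset.mem_filter.1 hv.1)
  have hsub : insert v C ⊆ A := Finset.insert_subset hv.1 hC.1
  have hP : PR G T A.card (insert v C) := by
    refine .place C v hC.2 hvA.1 ?_ (Finset.card_le_card hsub)
    intro u hu
    rw [mem_preds] at hu
    rw [Finset.mem_union]
    by_contra hcon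
    rw [not_or] at hcon
    have huA : u ∈ A := by
      rw [hA, Finset.mem_filter]
      exact ⟨(hG.2.1 _ hu).1, Relation.ReflTransGen.head ⟨hu, hcon.2, hvA.2.notMem hs⟩ hvA.2⟩
    exact hmin u (Finset.mem_sdiff.2 ⟨huA, hcon.1⟩) (Relation.TransGen.single hu)
  have := hmax _ ⟨hsub, hP⟩
  rw [Finset.card_insert_of_notMem hv.2] at this
  omega

/-- The critical assignment at `v`. -/
noncomputable def crit (G : PGraph) (T : Finset ℕ) (v : ℕ) : ℕ → Bool :=
  fun u => !(decide (RT G T v u))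

theorem crit_sat (G : PGraph) (T : Finset ℕ) (v u : ℕ) (hu : u ≠ v) (hs : RT G T v G.sink) :
    clauseSat (crit G T v) (ClauseOf G u) := by
  by_cases h : RT G T v u
  · rcases Relation.ReflTransGen.cases_tail h with e | ⟨c, hc, hcu⟩
    · exact absurd e hu
    · refine ⟨(c, false), ?_, ?_⟩
      · simp [ClauseOf, mem_preds, hcu.1]
      · have : RT G T v c := hc
        simp [crit, this]
  · have hne : u ≠ G.sink := fun e => h (e ▸ hs)
    exact ⟨(u, true), by simp [ClauseOf, hne], by simp [crit, h]⟩

theorem clauseSat.mono {a : ℕ → Bool} {C D : Clause} (h : clauseSat a C) (hCD : C ⊆ D) :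
    clauseSat a D := by
  obtain ⟨l, hl, h⟩ := h
  exact ⟨l, hCD hl, h⟩

theorem find_leaf (S : Set Clause) (a : ℕ → Bool) (t : RTree) (hv : valid S t)
    (hf : ¬ clauseSat a (conc t)) :
    ∃ C ∈ S, ¬ clauseSat a C ∧ ∀ l ∈ C, l ∈ conc t ∨ l.1 ∈ resolvedVars t := by
  induction t with
  | leaf C => exact ⟨C, hv, hf, fun l hl => Or.inl hl⟩
  | node x l r ihl ihr =>
    obtain ⟨_, _, hvl, hvr⟩ := hv
    have aux : ∀ (b : Bool) (D : Clause), D.erase (x, b) ⊆ conc (.node x l r) →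
        a x = !b → ¬ clauseSat a D := by
      rintro b D hD hab ⟨m, hm, hs⟩
      apply hf
      refine ⟨m, hD (Finset.mem_erase.2 ⟨?_, hm⟩), hs⟩
      rintro rfl
      cases b <;> simp [hab] at hs
    have hL : (conc l).erase (x, true) ⊆ conc (.node x l r) := Finset.subset_union_left
    have hR : (conc r).erase (x, false) ⊆ conc (.node x l r) := Finset.subset_union_right
    cases hax : a x with
    | false =>
      obtain ⟨C, hC, h1, h2⟩ := ihl hvl (aux true _ hL (by simpa using hax))
      refine ⟨C, hC, h1, fun m hm => ?_⟩
      rcases h2 m hm with h | h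
      · by_cases e : m = (x, true)
        · right; simp [resolvedVars, e]
        · left; exact hL (Finset.mem_erase.2 ⟨e, h⟩)
      · right; simp [resolvedVars, h]
    | true =>
      obtain ⟨C, hC, h1, h2⟩ := ihr hvr (aux false _ hR (by simpa using hax))
      refine ⟨C, hC, h1, fun m hm => ?_⟩
      rcases h2 m hm with h | h
      · by_cases e : m = (x, false)
        · right; simp [resolvedVars, e]
        · left; exact hR (Finset.mem_erase.2 ⟨e, h⟩)
      · right; simp [resolvedVars, h]

theorem card_conc_le (t : RTree) : (conc t).card ≤ twidth t := by
  cases t with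
  | leaf C => exact le_rfl
  | node x l r => exact le_max_left _ _

theorem RT.ins {G : PGraph} {T : Finset ℕ} {s x u : ℕ} (h : RT G T s u)
    (hx : ¬ RT G T s x) : RT G (insert x T) s u := by
  induction h with
  | refl => exact .refl
  | @tail b c hb hbc ih =>
    refine Relation.ReflTransGen.tail ih ⟨hbc.1, ?_, ?_⟩
    · rw [Finset.mem_insert, not_or]
      exact ⟨fun e => hx (e ▸ hb), hbc.2.1⟩
    · rw [Finset.mem_insert, not_or]
      exact ⟨fun e => hx (e ▸ hb.tail hbc), hbc.2.2⟩

/-- State of the Adversary: `T` true variables, `s` the current sink, `Q` queried variables. -/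
structure AdvInv (G : PGraph) (T Q : Finset ℕ) (s : ℕ) : Prop where
  sT : s ∉ T
  sV : s ∈ G.verts
  sS : RT G T s G.sink
  cost : ∀ j C, PR G T j C → s ∈ C →
    pebNum G ≤ j + (Q.filter (fun x => x ∈ G.verts.erase G.sink)).card

/-- The Adversary's answer to the query `x`. -/
theorem adv_step {G : PGraph} (hG : IsPointed G) {T Q : Finset ℕ} {s : ℕ} (h : AdvInv G T Q s)
    (x : ℕ) (hxQ : x ∉ Q) :
    ∃ T' s', AdvInv G T' (insert x Q) s' ∧ T ⊆ T' ∧ (∀ u, RT G T s u → RT G T' s' u) ∧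
      (x ∈ T' ∨ RT G T' s' x) := by
  have hle : (Q.filter (fun x => x ∈ G.verts.erase G.sink)).card ≤
      ((insert x Q).filter (fun x => x ∈ G.verts.erase G.sink)).card :=
    Finset.card_le_card (Finset.filter_subset_filter _ (Finset.subset_insert _ _))
  by_cases h1 : RT G T s x
  · refine ⟨T, s, ⟨h.sT, h.sV, h.sS, fun j C hC hs => ?_⟩, subset_rfl, fun _ h => h, Or.inr h1⟩
    have := h.cost j C hC hs
    omega
  have hsx : s ≠ x := fun e => h1 (e ▸ Relation.ReflTransGen.refl)
  have hsT' : s ∉ insert x T := by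
    rw [Finset.mem_insert, not_or]; exact ⟨hsx, h.sT⟩
  by_cases h2 : RT G T x s
  · have hxT : x ∉ T := h2.notMem h.sT
    have hxV : x ∈ G.verts := by
      rcases Relation.ReflTransGen.cases_head h2 with e | ⟨c, hc, _⟩
      · exact e ▸ h.sV
      · exact (hG.2.1 _ hc.1).1
    have hxS : x ≠ G.sink := fun e => h1 (e ▸ h.sS)
    have hcard : ((insert x Q).filter (fun x => x ∈ G.verts.erase G.sink)).card =
        (Q.filter (fun x => x ∈ G.verts.erase G.sink)).card + 1 := by
      rw [Finset.filter_insert, if_pos (Finset.mem_erase.2 ⟨hxS, hxV⟩),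
        Finset.card_insert_of_notMem]
      simp [hxQ]
    by_cases h3 : ∃ j C, PR G T j C ∧ x ∈ C ∧
        j + (Q.filter (fun x => x ∈ G.verts.erase G.sink)).card + 1 < pebNum G
    · obtain ⟨j, C, hC, hxC, hj⟩ := h3
      refine ⟨insert x T, s, ⟨hsT', h.sV, h.sS.ins h1, fun j' C' hC' hs' => ?_⟩,
        Finset.subset_insert _ _, fun u hu => hu.ins h1, Or.inl (Finset.mem_insert_self _ _)⟩
      have hc := PR.compose (hC.mono (le_max_left j j')) hxC (hC'.mono (le_max_right j j'))
      have := h.cost _ _ hc (Finset.mem_insert_of_mem hs')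
      rcases max_cases j j' with e | e <;> omega
    · push Not at h3
      refine ⟨T, x, ⟨hxT, hxV, h2.trans h.sS, fun j C hC hs => ?_⟩, subset_rfl,
        fun u hu => h2.trans hu, Or.inr Relation.ReflTransGen.refl⟩
      have := h3 j C hC hs
      omega
  · refine ⟨insert x T, s, ⟨hsT', h.sV, h.sS.ins h1, fun j' C' hC' hs' => ?_⟩,
        Finset.subset_insert _ _, fun u hu => hu.ins h1, Or.inl (Finset.mem_insert_self _ _)⟩
    have := h.cost _ _ (PR.irrel h.sT h2 hC')
      (Finset.mem_filter.2 ⟨hs', Relation.ReflTransGen.refl⟩)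
    omega


theorem crit_falsifies {G : PGraph} {T : Finset ℕ} {s v : ℕ} {C : Clause} (hs : s ∉ T)
    (hv : RT G T v s) (h1 : ∀ x, (x, true) ∈ C → RT G T s x)
    (h2 : ∀ x, (x, false) ∈ C → x ∈ T) : ¬ clauseSat (crit G T v) C := by
  rintro ⟨⟨x, b⟩, hx, hsat⟩
  cases b with
  | true =>
    have : RT G T v x := hv.trans (h1 x hx)
    simp [crit, this] at hsat
  | false =>
    have : ¬ RT G T v x := fun h => h.notMem' (hv.notMem hs) (h2 x hx)
    simp [crit, this] at hsat

theorem phase_two (G : PGraph) (hG : IsPointed G)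
    (p : ℕ) (σ : ℕ → Fin p → ℕ)
    (hgood : ∀ A ⊆ G.verts, ∀ B ⊆ G.verts.erase G.sink,
      A.card = pebNum G / 2 → B.card = pebNum G / 2 →
      (pebNum G : ℝ) / 4 ≤ ((B.filter (fun x => ∃ v ∈ A, ∃ i, σ v i = x)).card : ℝ))
    (t : RTree) (T Q : Finset ℕ) (s : ℕ) (hval : valid (PebS G σ) t)
    (hw : (twidth t : ℝ) < (pebNum G : ℝ) / 4) (hI : AdvInv G T Q s)
    (hQ : ∀ x ∈ Q, x ∉ resolvedVars t)
    (h1 : ∀ x, (x, true) ∈ conc t → RT G T s x) (h2 : ∀ x, (x, false) ∈ conc t → x ∈ T)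
    (hB : (Q.filter (fun x => x ∈ G.verts.erase G.sink)).card = pebNum G / 2) : False := by
  obtain ⟨C, hC, hsC⟩ := pebble_all hG T s hI.sT hI.sV
  have hN := hI.cost _ _ hC hsC
  obtain ⟨A, hAsub, hAcard⟩ := Finset.exists_subset_card_eq
    (s := G.verts.filter (fun v => RT G T v s)) (n := pebNum G / 2) (by omega)
  have hg := hgood A (hAsub.trans (Finset.filter_subset _ _))
    (Q.filter (fun x => x ∈ G.verts.erase G.sink))
    (fun x hx => (Finset.mem_filter.1 hx).2) hAcard hB
  have hlt : ((conc t).image Prod.fst).card <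
      ((Q.filter (fun x => x ∈ G.verts.erase G.sink)).filter
        (fun x => ∃ v ∈ A, ∃ i, σ v i = x)).card := by
    refine lt_of_le_of_lt (Finset.card_image_le.trans (card_conc_le t)) ?_
    exact_mod_cast hw.trans_le hg
  obtain ⟨x, hx, hxn⟩ := Finset.exists_mem_notMem_of_card_lt_card hlt
  rw [Finset.mem_filter, Finset.mem_filter] at hx
  obtain ⟨⟨hxQ, _⟩, v, hvA, i, hi⟩ := hx
  have hv := (Finset.mem_filter.1 (hAsub hvA)).2
  obtain ⟨D, hD, hnot, hsub⟩ := find_leaf _ (crit G T v) t hval (crit_falsifies hI.sT hv h1 h2)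
  obtain ⟨w, hw, ε, rfl⟩ := hD
  by_cases hwv : w = v
  · subst hwv
    have hm := hsub (σ w i, ε i) (Finset.mem_union_right _
      (Finset.mem_image_of_mem _ (Finset.mem_univ i)))
    rw [hi] at hm
    rcases hm with hm | hm
    · exact hxn (Finset.mem_image_of_mem Prod.fst hm)
    · exact hQ x hxQ hm
  · exact hnot ((crit_sat G T v w hwv (hv.trans hI.sS)).mono Finset.subset_union_left)

theorem main_aux (G : PGraph) (hG : IsPointed G)
    (p : ℕ) (σ : ℕ → Fin p → ℕ)
    (hgood : ∀ A ⊆ G.verts, ∀ B ⊆ G.verts.erase G.sink,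
      A.card = pebNum G / 2 → B.card = pebNum G / 2 →
      (pebNum G : ℝ) / 4 ≤ ((B.filter (fun x => ∃ v ∈ A, ∃ i, σ v i = x)).card : ℝ))
    (t : RTree) : ∀ (T Q : Finset ℕ) (s : ℕ), valid (PebS G σ) t → regular t →
      (twidth t : ℝ) < (pebNum G : ℝ) / 4 → AdvInv G T Q s →
      (∀ x ∈ Q, x ∉ resolvedVars t) →
      (∀ x, (x, true) ∈ conc t → RT G T s x) → (∀ x, (x, false) ∈ conc t → x ∈ T) →
      (Q.filter (fun x => x ∈ G.verts.erase G.sink)).card ≤ pebNum G / 2 → False := by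
  induction t with
  | leaf C =>
    intro T Q s hval hreg hw hI hQ h1 h2 hB
    rcases hB.eq_or_lt with hB | hB
    · exact phase_two G hG p σ hgood _ T Q s hval hw hI hQ h1 h2 hB
    obtain ⟨D, hD, hsD⟩ := pebble_all hG T s hI.sT hI.sV
    have hN := hI.cost _ _ hD hsD
    obtain ⟨w, hw, ε, hC⟩ := hval
    obtain ⟨v, hv, hvw⟩ := Finset.exists_mem_ne
      (s := G.verts.filter (fun v => RT G T v s)) (by omega) w
    have hv := (Finset.mem_filter.1 hv).2
    refine crit_falsifies hI.sT hv h1 h2 ?_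
    refine (crit_sat G T v w hvw.symm (hv.trans hI.sS)).mono ?_
    show _ ⊆ C
    rw [hC]
    exact Finset.subset_union_left
  | node x l r ihl ihr =>
    intro T Q s hval hreg hw hI hQ h1 h2 hB
    rcases hB.eq_or_lt with hB | hB
    · exact phase_two G hG p σ hgood _ T Q s hval hw hI hQ h1 h2 hB
    obtain ⟨_, _, hvl, hvr⟩ := hval
    obtain ⟨hxl, hxr, hrl, hrr⟩ := hreg
    have hxQ : x ∉ Q := fun h => hQ x h (by simp [resolvedVars])
    obtain ⟨T', s', hI', hTT, hRR, hx⟩ := adv_step hG hI x hxQ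
    have hB' : ((insert x Q).filter (fun x => x ∈ G.verts.erase G.sink)).card
        ≤ pebNum G / 2 := by
      rw [Finset.filter_insert]
      split_ifs
      · exact (Finset.card_insert_le _ _).trans (by omega)
      · omega
    have hL : (conc l).erase (x, true) ⊆ conc (.node x l r) := Finset.subset_union_left
    have hR : (conc r).erase (x, false) ⊆ conc (.node x l r) := Finset.subset_union_right
    have hwl : (twidth l : ℝ) < (pebNum G : ℝ) / 4 := by
      refine lt_of_le_of_lt ?_ hw
      exact_mod_cast (le_max_left _ _).trans (le_max_right _ _)
    have hwr : (twidth r : ℝ) < (pebNum G : ℝ) / 4 := by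
      refine lt_of_le_of_lt ?_ hw
      exact_mod_cast (le_max_right _ _).trans (le_max_right _ _)
    rcases hx with hx | hx
    · refine ihr T' (insert x Q) s' hvr hrr hwr hI' ?_ ?_ ?_ hB'
      · intro y hy
        rcases Finset.mem_insert.1 hy with e | hy
        · rwa [e]
        · intro h
          exact hQ y hy (by simp [resolvedVars, h])
      · intro y hy
        exact hRR y (h1 y (hR (Finset.mem_erase.2 ⟨by simp, hy⟩)))
      · intro y hy
        by_cases e : y = x
        · rwa [e]
        · exact hTT (h2 y (hR (Finset.mem_erase.2 ⟨by simp [e], hy⟩)))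
    · refine ihl T' (insert x Q) s' hvl hrl hwl hI' ?_ ?_ ?_ hB'
      · intro y hy
        rcases Finset.mem_insert.1 hy with e | hy
        · rwa [e]
        · intro h
          exact hQ y hy (by simp [resolvedVars, h])
      · intro y hy
        by_cases e : y = x
        · rwa [e]
        · exact hRR y (h1 y (hL (Finset.mem_erase.2 ⟨by simp [e], hy⟩)))
      · intro y hy
        exact hTT (h2 y (hL (Finset.mem_erase.2 ⟨by simp, hy⟩)))

theorem reach_empty {G : PGraph} : RT G ∅ G.sink G.sink := Relation.ReflTransGen.refl

/-- If G is a pointed graph with pebbling number N and σ is good for G, N/2 and p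
(every two sets A of vertices and B of variables of size ⌊N/2⌋ satisfy
|σ(A) ∩ B| ≥ N/4), then every regular resolution refutation of Peb^σ(G) contains a
clause of width at least N/4. -/
theorem pebS_regular_width_lower_bound (G : PGraph) (hG : IsPointed G)
    (p : ℕ) (hp : 0 < p) (σ : ℕ → Fin p → ℕ)
    (hgood : ∀ A ⊆ G.verts, ∀ B ⊆ G.verts.erase G.sink,
      A.card = pebNum G / 2 → B.card = pebNum G / 2 →
      (pebNum G : ℝ) / 4 ≤ ((B.filter (fun x => ∃ v ∈ A, ∃ i, σ v i = x)).card : ℝ)) :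
    ∀ t : RTree, IsTreeRefutation (PebS G σ) t → regular t →
      (pebNum G : ℝ) / 4 ≤ (twidth t : ℝ) := by
  intro t ht hreg
  by_contra hcon
  refine main_aux G hG p σ hgood t ∅ ∅ G.sink ht.1 hreg (not_le.1 hcon)
    ⟨by simp, hG.1, reach_empty, fun j C hC hs => ?_⟩ (by simp) ?_ ?_ (by simp)
  · have := pebNum_le hC hs
    omega
  · intro x hx
    rw [ht.2] at hx
    simp at hx
  · intro x hx
    rw [ht.2] at hx
    simp at hx
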